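/- Let G be a strongly regular graph with parameters (1911, 270, 105, 27), and let C₁ and C₂ be cliques of G with distinct vertex sets, each of order at least 29, whose vertex sets intersect in at least 22 vertices. Then one of the following holds: (1) there is a vertex z in the symmetric difference V(C₁) △ V(C₂) that is adjacent to every vertex of (V(C₁) △ V(C₂)) \ {z}; or (2) |V(C₁) ∩ V(C₂)| = 27, both C₁ and C₂ have exactly 29 vertices, and both are maximal cliques. -/

import Mathlib

open Finset Matrix

namespace SimpleGraph

section Gram

variable {V : Type*} [DecidableEq V] (G : SimpleGraph V) [DecidableRel G.Adj]

/-- For a strongly regular graph with parameters `(1911, 270, 105, 27)`, whose least adjacency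
eigenvalue is `-3`, this is `588` times the projection onto the eigenspace of the eigenvalue `81`. -/
def gram1911 : Matrix V V ℤ :=
  Matrix.of fun u v => if u = v then 20 else if G.Adj u v then 6 else -1

theorem gram1911_comm (u v : V) : G.gram1911 u v = G.gram1911 v u := by
  simp [gram1911, G.adj_comm u v, eq_comm (a := u)]

theorem isSymm_gram1911 : G.gram1911.IsSymm :=
  Matrix.IsSymm.ext fun u v => G.gram1911_comm v u

/-- The sum of the entries of `gram1911` over a rectangle. -/
def gramSum1911 (S T : Finset V) : ℤ := ∑ u ∈ S, ∑ v ∈ T, G.gram1911 u v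

variable {G}

theorem gramSum1911_comm (S T : Finset V) : G.gramSum1911 S T = G.gramSum1911 T S :=
  Finset.sum_comm.trans
    (Finset.sum_congr rfl fun v _ => Finset.sum_congr rfl fun u _ => G.gram1911_comm u v)

theorem gramSum1911_self {S : Finset V} (hS : G.IsClique (S : Set V)) :
    G.gramSum1911 S S = #S * (14 + 6 * #S) := by
  have hrow : ∀ u ∈ S, ∑ v ∈ S, G.gram1911 u v = 14 + 6 * #S := by
    intro u hu
    have : ∀ v ∈ S, G.gram1911 u v = (if u = v then 14 else 0) + 6 := by
      intro v hv
      by_cases huv : u = v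
      · simp [gram1911, huv]
      · simp [gram1911, huv, hS hu hv huv]
    rw [Finset.sum_congr rfl this, Finset.sum_add_distrib]
    simp [hu]
    ring
  rw [gramSum1911, Finset.sum_congr rfl hrow]
  simp

theorem gramSum1911_of_disjoint {S T : Finset V} (hST : Disjoint S T) :
    G.gramSum1911 S T = 7 * ∑ u ∈ S, (#(T.bipartiteAbove G.Adj u) : ℤ) - #S * #T := by
  have hrow : ∀ u ∈ S, ∑ v ∈ T, G.gram1911 u v = 7 * #(T.bipartiteAbove G.Adj u) - #T := by
    intro u hu
    have : ∀ v ∈ T, G.gram1911 u v = 7 * (if G.Adj u v then 1 else 0) - 1 := by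
      intro v hv
      have huv : u ≠ v := fun e => Finset.disjoint_left.1 hST hu (e ▸ hv)
      by_cases ha : G.Adj u v <;> simp [gram1911, huv, ha]
    rw [Finset.sum_congr rfl this, Finset.sum_sub_distrib, ← Finset.mul_sum]
    simp [bipartiteAbove]
  rw [gramSum1911, Finset.sum_congr rfl hrow, Finset.sum_sub_distrib, ← Finset.mul_sum]
  simp

theorem gramSum1911_of_adj {S T : Finset V} (hST : ∀ u ∈ S, ∀ v ∈ T, G.Adj u v) :
    G.gramSum1911 S T = 6 * #S * #T := by
  have hrow : ∀ u ∈ S, ∑ v ∈ T, G.gram1911 u v = 6 * #T := by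
    intro u hu
    have : ∀ v ∈ T, G.gram1911 u v = 6 := by
      intro v hv
      simp [gram1911, hST u hu v hv, (hST u hu v hv).ne]
    rw [Finset.sum_congr rfl this]
    simp [mul_comm]
  rw [gramSum1911, Finset.sum_congr rfl hrow]
  simp
  ring

theorem gram1911_eq :
    G.gram1911 = (7 : ℤ) • G.adjMatrix ℤ + (21 : ℤ) • (1 : Matrix V V ℤ) -
      Matrix.of fun _ _ => 1 := by
  ext u v
  rw [Matrix.sub_apply, Matrix.add_apply, Matrix.smul_apply, Matrix.smul_apply]
  by_cases huv : u = v
  · subst huv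
    simp [gram1911]
  · by_cases ha : G.Adj u v <;> simp [gram1911, huv, ha]

variable [Fintype V]

theorem IsSRGWith.gram1911_mul_self (h : G.IsSRGWith 1911 270 105 27) :
    G.gram1911 * G.gram1911 = 588 • G.gram1911 := by
  set J : Matrix V V ℤ := Matrix.of fun _ _ => 1 with hJ
  have hJA : J * G.adjMatrix ℤ = 270 • J := by
    ext u v
    simp [hJ, h.regular.degree_eq v]
  have hAJ : G.adjMatrix ℤ * J = 270 • J := by
    ext u v
    simp [hJ, h.regular.degree_eq u]
  have hJJ : J * J = 1911 • J := by
    ext u v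
    simp [hJ, Matrix.mul_apply, h.card]
  have hcompl : Gᶜ.adjMatrix ℤ = J - 1 - G.adjMatrix ℤ := by
    ext u v
    by_cases huv : u = v
    · subst huv
      simp [hJ]
    · by_cases ha : G.Adj u v <;> simp [hJ, huv, ha]
  have hAA := h.matrix_eq (α := ℤ)
  rw [pow_two, hcompl] at hAA
  rw [gram1911_eq, ← hJ]
  simp only [add_mul, mul_add, sub_mul, mul_sub, smul_mul_assoc, mul_smul_comm, hJA, hAJ, hJJ,
    hAA, mul_one, one_mul]
  module

theorem IsSRGWith.gram1911_nonneg (h : G.IsSRGWith 1911 270 105 27) (f : V → ℤ) :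
    0 ≤ f ⬝ᵥ G.gram1911 *ᵥ f := by
  have key : (G.gram1911 *ᵥ f) ⬝ᵥ (G.gram1911 *ᵥ f) = 588 * (f ⬝ᵥ G.gram1911 *ᵥ f) := by
    have hcomm : f ᵥ* G.gram1911 = G.gram1911 *ᵥ f := by
      rw [← Matrix.mulVec_transpose, G.isSymm_gram1911.eq]
    nth_rw 1 [← hcomm]
    rw [← Matrix.dotProduct_mulVec, Matrix.mulVec_mulVec, h.gram1911_mul_self, Matrix.smul_mulVec,
      dotProduct_smul]
    simp
  have : 0 ≤ (G.gram1911 *ᵥ f) ⬝ᵥ (G.gram1911 *ᵥ f) :=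
    Finset.sum_nonneg fun i _ => mul_self_nonneg _
  linarith

theorem dotProduct_gram1911_mulVec_indicator (S T : Finset V) :
    (fun v => if v ∈ S then (1 : ℤ) else 0) ⬝ᵥ
      G.gram1911 *ᵥ (fun v => if v ∈ T then (1 : ℤ) else 0) = G.gramSum1911 S T := by
  simp [gramSum1911, dotProduct, Matrix.mulVec]

/-- The determinant inequality given by positivity of `gram1911` on the characteristic vectors of a
clique `C` and of `P ∪ Q`, where `P` and `Q` extend `C` to larger cliques. -/
theorem IsSRGWith.clique_pair_le (h : G.IsSRGWith 1911 270 105 27) {C P Q : Finset V}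
    (hC : G.IsClique (C : Set V)) (hP : G.IsClique (P : Set V)) (hQ : G.IsClique (Q : Set V))
    (hCP : ∀ u ∈ C, ∀ v ∈ P, G.Adj u v) (hCQ : ∀ u ∈ C, ∀ v ∈ Q, G.Adj u v)
    (hPQ : Disjoint P Q) :
    36 * (#C : ℤ) * (#P + #Q) ^ 2 ≤ (14 + 6 * #C) *
      (#P * (14 + 6 * #P) + #Q * (14 + 6 * #Q) - 2 * #P * #Q +
        14 * ∑ u ∈ P, (#(Q.bipartiteAbove G.Adj u) : ℤ)) := by
  let ind (S : Finset V) : V → ℤ := fun v => if v ∈ S then 1 else 0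
  have hind (S T : Finset V) : ind S ⬝ᵥ G.gram1911 *ᵥ ind T = G.gramSum1911 S T :=
    dotProduct_gram1911_mulVec_indicator S T
  have hpos := h.gram1911_nonneg
    ((-6 * (#P + #Q) : ℤ) • ind C + (14 + 6 * #C : ℤ) • (ind P + ind Q))
  simp only [Matrix.mulVec_add, Matrix.mulVec_smul, dotProduct_add, add_dotProduct,
    smul_dotProduct, dotProduct_smul, hind, smul_eq_mul, gramSum1911_comm P C,
    gramSum1911_comm Q C, gramSum1911_comm Q P, gramSum1911_self hC, gramSum1911_self hP,
    gramSum1911_self hQ, gramSum1911_of_adj hCP, gramSum1911_of_adj hCQ,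
    gramSum1911_of_disjoint hPQ] at hpos
  have hc : (0 : ℤ) < 14 + 6 * #C := by positivity
  refine le_of_sub_nonneg (nonneg_of_mul_nonneg_right ?_ hc)
  linear_combination hpos

end Gram

theorem sum_bipartiteAbove_le_sq {α β : Type*} (r : α → β → Prop) [∀ a b, Decidable (r a b)]
    {P : Finset α} {Q : Finset β} {e : ℕ} (hP : #P = e + 2) (hQ : #Q = e + 2)
    (hleft : ∀ a ∈ P, #(Q.bipartiteAbove r a) ≤ e) (hright : ∀ b ∈ Q, #(P.bipartiteBelow r b) ≤ e)
    (hsum : ∀ a ∈ P, ∀ b ∈ Q, ¬ r a b →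
      #(Q.bipartiteAbove r a) + #(P.bipartiteBelow r b) ≤ e) :
    ∑ a ∈ P, #(Q.bipartiteAbove r a) ≤ e ^ 2 := by
  obtain ⟨a, ha, hmax⟩ := P.exists_max_image (fun a => #(Q.bipartiteAbove r a))
    (Finset.card_pos.1 (by omega))
  obtain ⟨d, hd⟩ : ∃ d, d = #(Q.bipartiteAbove r a) := ⟨_, rfl⟩
  have hde : d ≤ e := hd ▸ hleft a ha
  have htriv : ∑ a ∈ P, #(Q.bipartiteAbove r a) ≤ (e + 2) * d := by
    have := Finset.sum_le_card_nsmul P _ d fun b hb => hd ▸ hmax b hb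
    simpa [hP] using this
  have hsplit : ∑ a ∈ P, #(Q.bipartiteAbove r a) ≤ d * e + (e + 2 - d) * (e - d) := by
    rw [Finset.sum_card_bipartiteAbove_eq_sum_card_bipartiteBelow,
      ← Finset.sum_filter_add_sum_filter_not Q (r a)]
    have hcard : #{b ∈ Q | r a b} + #{b ∈ Q | ¬ r a b} = e + 2 := by
      rw [Finset.card_filter_add_card_filter_not, hQ]
    have hd' : #{b ∈ Q | r a b} = d := hd.symm
    refine Nat.add_le_add ?_ ?_
    · have := Finset.sum_le_card_nsmul {b ∈ Q | r a b} (fun b => #(P.bipartiteBelow r b)) e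
        fun b hb => hright b (Finset.mem_filter.1 hb).1
      simpa [hd'] using this
    · have := Finset.sum_le_card_nsmul {b ∈ Q | ¬ r a b} (fun b => #(P.bipartiteBelow r b)) (e - d)
        fun b hb => by
          have := hsum a ha b (Finset.mem_filter.1 hb).1 (Finset.mem_filter.1 hb).2
          omega
      rwa [smul_eq_mul, show #{b ∈ Q | ¬ r a b} = e + 2 - d by omega] at this
  obtain ⟨t, rfl⟩ := Nat.exists_eq_add_of_le hde
  rw [show d + t + 2 - d = t + 2 by omega, show d + t - d = t by omega] at hsplit
  rcases Nat.lt_or_ge d 2 with hd2 | hd2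
  · interval_cases d
    · nlinarith
    · rcases Nat.eq_zero_or_pos t with rfl | ht
      · simpa using hsplit
      · nlinarith
  · nlinarith

section Cliques

variable {V : Type*} [Fintype V] [DecidableEq V] {G : SimpleGraph V} [DecidableRel G.Adj]

theorem IsSRGWith.card_add_card_bipartite_le {n k l m : ℕ} (h : G.IsSRGWith n k l m)
    {C₁ C₂ : Finset V} (h₁ : G.IsClique (C₁ : Set V)) (h₂ : G.IsClique (C₂ : Set V))
    {u v : V} (hu : u ∈ C₁ \ C₂) (hv : v ∈ C₂ \ C₁) (huv : ¬ G.Adj u v) :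
    #(C₁ ∩ C₂) + (#((C₂ \ C₁).bipartiteAbove G.Adj u) +
      #((C₁ \ C₂).bipartiteBelow G.Adj v)) ≤ m := by
  have hne : u ≠ v := by
    rintro rfl
    simp_all
  rw [← h.of_not_adj hne huv, ← Set.toFinset_card, ← Finset.card_union_of_disjoint,
    ← Finset.card_union_of_disjoint]
  · refine Finset.card_le_card fun w hw => ?_
    simp only [Finset.mem_union, Finset.mem_inter, mem_bipartiteAbove, mem_bipartiteBelow,
      Finset.mem_sdiff] at hw hu hv
    simp only [Set.mem_toFinset, mem_commonNeighbors]
    rcases hw with ⟨hw₁, hw₂⟩ | ⟨⟨hw₂, hw₁⟩, hw⟩ | ⟨⟨hw₁, hw₂⟩, hw⟩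
    · exact ⟨h₁ hu.1 hw₁ (by rintro rfl; exact hu.2 hw₂),
        h₂ hv.1 hw₂ (by rintro rfl; exact hv.2 hw₁)⟩
    · exact ⟨hw, h₂ hv.1 hw₂ (by rintro rfl; exact huv hw)⟩
    · exact ⟨h₁ hu.1 hw₁ (by rintro rfl; exact huv hw), hw.symm⟩
  · rw [Finset.disjoint_left]
    intro w hw
    simp only [Finset.mem_union, Finset.mem_inter, mem_bipartiteAbove, mem_bipartiteBelow,
      Finset.mem_sdiff] at hw ⊢
    tauto
  · rw [Finset.disjoint_left]
    intro w hw
    simp only [mem_bipartiteAbove, mem_bipartiteBelow, Finset.mem_sdiff] at hw ⊢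
    tauto

/-- `IsSRGWith.clique_pair_le` for the intersection of two cliques and subsets of their
differences. -/
theorem IsSRGWith.inter_clique_pair_le (h : G.IsSRGWith 1911 270 105 27) {C₁ C₂ P Q : Finset V}
    (h₁ : G.IsClique (C₁ : Set V)) (h₂ : G.IsClique (C₂ : Set V))
    (hP : P ⊆ C₁ \ C₂) (hQ : Q ⊆ C₂ \ C₁) :
    36 * (#(C₁ ∩ C₂) : ℤ) * (#P + #Q) ^ 2 ≤ (14 + 6 * #(C₁ ∩ C₂)) *
      (#P * (14 + 6 * #P) + #Q * (14 + 6 * #Q) - 2 * #P * #Q +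
        14 * ∑ u ∈ P, (#(Q.bipartiteAbove G.Adj u) : ℤ)) := by
  have hP' (v) (hv : v ∈ P) := Finset.mem_sdiff.1 (hP hv)
  have hQ' (v) (hv : v ∈ Q) := Finset.mem_sdiff.1 (hQ hv)
  refine h.clique_pair_le (h₁.subset (by exact_mod_cast Finset.inter_subset_left))
    (h₁.subset fun v hv => (hP' v hv).1) (h₂.subset fun v hv => (hQ' v hv).1) ?_ ?_ ?_
  · intro u hu v hv
    exact h₁ (Finset.mem_inter.1 hu).1 (hP' v hv).1
      (by rintro rfl; exact (hP' u hv).2 (Finset.mem_inter.1 hu).2)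
  · intro u hu v hv
    exact h₂ (Finset.mem_inter.1 hu).2 (hQ' v hv).1
      (by rintro rfl; exact (hQ' u hv).2 (Finset.mem_inter.1 hu).1)
  · rw [Finset.disjoint_left]
    exact fun v hv hv' => (hP' v hv).2 (hQ' v hv').1

theorem IsSRGWith.card_clique_le_29 (h : G.IsSRGWith 1911 270 105 27) {C₁ C₂ : Finset V}
    (h₁ : G.IsClique (C₁ : Set V)) (h₂ : G.IsClique (C₂ : Set V)) (hc₂ : 29 ≤ #C₂)
    (hint : #(C₁ ∩ C₂) = 27) (hna : ∀ u ∈ C₁ \ C₂, ∀ v ∈ C₂ \ C₁, ¬ G.Adj u v) :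
    #C₁ ≤ 29 := by
  by_contra! hlt
  have hd₁ := Finset.card_sdiff_add_card_inter C₁ C₂
  have hd₂ := Finset.card_sdiff_add_card_inter C₂ C₁
  rw [Finset.inter_comm] at hd₂
  obtain ⟨P, hP, hPc⟩ := Finset.exists_subset_card_eq (show 3 ≤ #(C₁ \ C₂) by omega)
  obtain ⟨Q, hQ, hQc⟩ := Finset.exists_subset_card_eq (show 2 ≤ #(C₂ \ C₁) by omega)
  have key := h.inter_clique_pair_le h₁ h₂ hP hQ
  have hzero : ∑ u ∈ P, (#(Q.bipartiteAbove G.Adj u) : ℤ) = 0 := by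
    refine Finset.sum_eq_zero fun u hu => ?_
    rw [Nat.cast_eq_zero, Finset.card_eq_zero, bipartiteAbove, Finset.filter_eq_empty_iff]
    exact fun v hv => hna u (hP hu) v (hQ hv)
  rw [hzero, hPc, hQc, hint] at key
  norm_num at key

theorem IsSRGWith.card_eq_29_and_maximal (h : G.IsSRGWith 1911 270 105 27) {C₁ C₂ : Finset V}
    (h₁ : G.IsClique (C₁ : Set V)) (h₂ : G.IsClique (C₂ : Set V)) (hc₁ : 29 ≤ #C₁)
    (hc₂ : 29 ≤ #C₂) (hint : #(C₁ ∩ C₂) = 27)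
    (hna : ∀ u ∈ C₁ \ C₂, ∀ v ∈ C₂ \ C₁, ¬ G.Adj u v) :
    #C₁ = 29 ∧ ∀ z ∉ C₁, ¬ ∀ w ∈ C₁, G.Adj z w := by
  refine ⟨(h.card_clique_le_29 h₁ h₂ hc₂ hint hna).antisymm hc₁, fun z hz hadj => ?_⟩
  obtain ⟨u, hu⟩ : (C₁ \ C₂).Nonempty := by
    have := Finset.card_sdiff_add_card_inter C₁ C₂
    exact Finset.card_pos.1 (by have := h.card_clique_le_29 h₁ h₂ hc₂ hint hna; omega)
  have hu' := Finset.mem_sdiff.1 hu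
  have hz₂ : z ∉ C₂ := fun hz₂ =>
    hna u hu z (Finset.mem_sdiff.2 ⟨hz₂, hz⟩) (hadj u hu'.1).symm
  have hclique : G.IsClique ((insert z C₁ : Finset V) : Set V) := by
    rw [Finset.coe_insert, isClique_insert]
    exact ⟨h₁, fun w hw _ => hadj w hw⟩
  have hinter : insert z C₁ ∩ C₂ = C₁ ∩ C₂ := Finset.insert_inter_of_notMem hz₂
  have := h.card_clique_le_29 hclique h₂ hc₂ (hinter ▸ hint) fun a ha v hv hav => by
    have hv' := Finset.mem_sdiff.1 hv
    have hvC : v ∈ C₂ \ C₁ :=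
      Finset.mem_sdiff.2 ⟨hv'.1, fun hv₁ => hv'.2 (Finset.mem_insert_of_mem hv₁)⟩
    have huz : u ∈ insert z C₁ \ C₂ :=
      Finset.mem_sdiff.2 ⟨Finset.mem_insert_of_mem hu'.1, hu'.2⟩
    have hzz : z ∈ insert z C₁ \ C₂ := Finset.mem_sdiff.2 ⟨Finset.mem_insert_self _ _, hz₂⟩
    rcases Finset.mem_insert.1 (Finset.mem_sdiff.1 ha).1 with rfl | ha₁
    · have hcount := h.card_add_card_bipartite_le hclique h₂ huz hv (hna u hu v hvC)
      have hpos : 0 < #((insert a C₁ \ C₂).bipartiteBelow G.Adj v) :=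
        Finset.card_pos.2 ⟨a, (mem_bipartiteBelow _).2 ⟨hzz, hav⟩⟩
      rw [hinter, hint] at hcount
      omega
    · exact hna a (Finset.mem_sdiff.2 ⟨ha₁, (Finset.mem_sdiff.1 ha).2⟩) v hvC hav
  rw [Finset.card_insert_of_notMem hz] at this
  omega

/-- If every vertex of each difference has a non-neighbour in the other one, then a large
intersection of two cliques of order at least `29` has `27` vertices. -/
theorem IsSRGWith.card_inter_eq_27 (h : G.IsSRGWith 1911 270 105 27) {C₁ C₂ : Finset V}
    (h₁ : G.IsClique (C₁ : Set V)) (h₂ : G.IsClique (C₂ : Set V)) (hc₁ : 29 ≤ #C₁)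
    (hc₂ : 29 ≤ #C₂) (hint : 22 ≤ #(C₁ ∩ C₂)) (hle : #(C₁ ∩ C₂) ≤ 27)
    (hnon₁ : ∀ u ∈ C₁ \ C₂, ∃ v ∈ C₂ \ C₁, ¬ G.Adj u v)
    (hnon₂ : ∀ v ∈ C₂ \ C₁, ∃ u ∈ C₁ \ C₂, ¬ G.Adj u v) :
    #(C₁ ∩ C₂) = 27 := by
  by_contra hne
  obtain ⟨e, he⟩ := Nat.exists_eq_add_of_le hle
  have hd₁ := Finset.card_sdiff_add_card_inter C₁ C₂
  have hd₂ := Finset.card_sdiff_add_card_inter C₂ C₁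
  rw [Finset.inter_comm] at hd₂
  obtain ⟨P, hP, hPc⟩ := Finset.exists_subset_card_eq (show e + 2 ≤ #(C₁ \ C₂) by omega)
  obtain ⟨Q, hQ, hQc⟩ := Finset.exists_subset_card_eq (show e + 2 ≤ #(C₂ \ C₁) by omega)
  have habove (u : V) : #(Q.bipartiteAbove G.Adj u) ≤ #((C₂ \ C₁).bipartiteAbove G.Adj u) :=
    Finset.card_le_card (Finset.filter_subset_filter _ hQ)
  have hbelow (v : V) : #(P.bipartiteBelow G.Adj v) ≤ #((C₁ \ C₂).bipartiteBelow G.Adj v) :=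
    Finset.card_le_card (Finset.filter_subset_filter _ hP)
  have hcount (u) (hu : u ∈ C₁ \ C₂) (v) (hv : v ∈ C₂ \ C₁) (huv : ¬ G.Adj u v) :
      #(Q.bipartiteAbove G.Adj u) + #(P.bipartiteBelow G.Adj v) ≤ e := by
    have := h.card_add_card_bipartite_le h₁ h₂ hu hv huv
    have := habove u
    have := hbelow v
    omega
  have hE := sum_bipartiteAbove_le_sq G.Adj hPc hQc
    (fun u hu => by
      obtain ⟨v, hv, huv⟩ := hnon₁ u (hP hu)
      exact le_of_add_le_left (hcount u (hP hu) v hv huv))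
    (fun v hv => by
      obtain ⟨u, hu, huv⟩ := hnon₂ v (hQ hv)
      exact le_of_add_le_right (hcount u hu v (hQ hv) huv))
    (fun u hu v hv huv => hcount u (hP hu) v (hQ hv) huv)
  have key := h.inter_clique_pair_le h₁ h₂ hP hQ
  rw [hPc, hQc] at key
  zify at hE
  have he₅ : e ≤ 5 := by omega
  obtain ⟨c, hc⟩ : ∃ c, c = #(C₁ ∩ C₂) := ⟨_, rfl⟩
  rw [← hc] at key he hne
  obtain rfl : c = 27 - e := by omega
  interval_cases e <;> norm_num at key hE hne <;> linarith

end Cliques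

end SimpleGraph

/-- Let `G` be a strongly regular graph with parameters `(1911, 270, 105, 27)` and let
`C₁ ≠ C₂` be (vertex sets of) cliques, each of order at least `29`, intersecting in at least
`22` vertices. Then either some vertex `z` of the symmetric difference `C₁ ∆ C₂` is adjacent
to all other vertices of `C₁ ∆ C₂`, or `C₁` and `C₂` intersect in exactly `27` vertices,
both have exactly `29` vertices, and both are maximal cliques. -/
theorem srg_1911_intersecting_cliques {V : Type*} [Fintype V] [DecidableEq V]
    (G : SimpleGraph V) [DecidableRel G.Adj] (h : G.IsSRGWith 1911 270 105 27)
    (C₁ C₂ : Finset V) (h₁ : G.IsClique (C₁ : Set V)) (h₂ : G.IsClique (C₂ : Set V))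
    (hne : C₁ ≠ C₂) (hc₁ : 29 ≤ C₁.card) (hc₂ : 29 ≤ C₂.card)
    (hint : 22 ≤ (C₁ ∩ C₂).card) :
    (∃ z ∈ symmDiff C₁ C₂, ∀ w ∈ symmDiff C₁ C₂, w ≠ z → G.Adj z w) ∨
    ((C₁ ∩ C₂).card = 27 ∧ C₁.card = 29 ∧ C₂.card = 29 ∧
      (∀ z ∉ C₁, ¬ ∀ w ∈ C₁, G.Adj z w) ∧ (∀ z ∉ C₂, ¬ ∀ w ∈ C₂, G.Adj z w)) := by
  by_cases hz : ∃ z ∈ symmDiff C₁ C₂, ∀ w ∈ symmDiff C₁ C₂, w ≠ z → G.Adj z w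
  · exact Or.inl hz
  right
  push Not at hz
  have hnon₁ : ∀ u ∈ C₁ \ C₂, ∃ v ∈ C₂ \ C₁, ¬ G.Adj u v := by
    intro u hu
    obtain ⟨v, hv, hvu, hna⟩ := hz u (Finset.mem_union_left _ hu)
    rcases Finset.mem_union.1 hv with hv | hv
    · exact absurd (h₁ (Finset.mem_sdiff.1 hu).1 (Finset.mem_sdiff.1 hv).1 hvu.symm) hna
    · exact ⟨v, hv, hna⟩
  have hnon₂ : ∀ v ∈ C₂ \ C₁, ∃ u ∈ C₁ \ C₂, ¬ G.Adj u v := by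
    intro v hv
    obtain ⟨u, hu, huv, hna⟩ := hz v (Finset.mem_union_right _ hv)
    rcases Finset.mem_union.1 hu with hu | hu
    · exact ⟨u, hu, fun ha => hna ha.symm⟩
    · exact absurd (h₂ (Finset.mem_sdiff.1 hv).1 (Finset.mem_sdiff.1 hu).1 huv.symm) hna
  obtain ⟨u, hu, v, hv, huv⟩ : ∃ u ∈ C₁ \ C₂, ∃ v ∈ C₂ \ C₁, ¬ G.Adj u v := by
    obtain ⟨z, hzm⟩ : (symmDiff C₁ C₂).Nonempty :=
      Finset.nonempty_iff_ne_empty.2 fun he => hne (symmDiff_eq_bot.1 he)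
    rcases Finset.mem_union.1 hzm with hzm | hzm
    · exact ⟨z, hzm, hnon₁ z hzm⟩
    · obtain ⟨u, hu, hna⟩ := hnon₂ z hzm
      exact ⟨u, hu, z, hzm, hna⟩
  have hcount := h.card_add_card_bipartite_le h₁ h₂ hu hv huv
  have h27 := h.card_inter_eq_27 h₁ h₂ hc₁ hc₂ hint (by omega) hnon₁ hnon₂
  have hna : ∀ u ∈ C₁ \ C₂, ∀ v ∈ C₂ \ C₁, ¬ G.Adj u v := by
    intro u hu v hv hadj
    obtain ⟨w, hw, huw⟩ := hnon₁ u hu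
    have hcount := h.card_add_card_bipartite_le h₁ h₂ hu hw huw
    have hpos : 0 < #((C₂ \ C₁).bipartiteAbove G.Adj u) :=
      Finset.card_pos.2 ⟨v, (mem_bipartiteAbove _).2 ⟨hv, hadj⟩⟩
    omega
  obtain ⟨hcard₁, hmax₁⟩ := h.card_eq_29_and_maximal h₁ h₂ hc₁ hc₂ h27 hna
  obtain ⟨hcard₂, hmax₂⟩ := h.card_eq_29_and_maximal h₂ h₁ hc₂ hc₁ (Finset.inter_comm C₁ C₂ ▸ h27)
    fun u hu v hv ha => hna v hv u hu ha.symm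
  exact ⟨h27, hcard₁, hcard₂, hmax₁, hmax₂⟩
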